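/- Let 5 ≤ N ≤ 7. Then there exists δ ∈ (0,1) such that ∫_{ℝ^N} V_ε(x)^{2N/(N−4)} dx = ∫_{ℝ^N} u_ε(x)^{2N/(N−4)} dx + O(ε^{(N−4+δ)/2}) as ε → 0⁺. -/

import Mathlib

open MeasureTheory Real Filter Asymptotics
open scoped Topology

/-- The Euclidean Laplacian: sum of second partial derivatives in the
coordinate directions. -/
noncomputable def lapl {N : ℕ} (u : EuclideanSpace ℝ (Fin N) → ℝ)
    (x : EuclideanSpace ℝ (Fin N)) : ℝ :=
  ∑ i : Fin N, fderiv ℝ (fun y => fderiv ℝ u y (EuclideanSpace.single i 1)) x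
    (EuclideanSpace.single i 1)

/-- The function `u_ε(x) = [N(N−4)(N²−4)ε²]^{(N−4)/8} / (ε + |x|²)^{(N−4)/2}`. -/
noncomputable def bubble (N : ℕ) (ε : ℝ) (x : EuclideanSpace ℝ (Fin N)) : ℝ :=
  ((N : ℝ) * ((N : ℝ) - 4) * ((N : ℝ) ^ 2 - 4) * ε ^ 2) ^ (((N : ℝ) - 4) / 8) /
    (ε + ‖x‖ ^ 2) ^ (((N : ℝ) - 4) / 2)

/-- The truncated function `V_ε(x) = g(|x|) u_ε(x)`. -/
noncomputable def cutBubble (N : ℕ) (g : ℝ → ℝ) (ε : ℝ)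
    (x : EuclideanSpace ℝ (Fin N)) : ℝ :=
  g ‖x‖ * bubble N ε x

/-- The critical power of the bubble, with exponents simplified. -/
lemma bubble_rpow_critical (N : ℕ) (hN : 5 ≤ N) {ε : ℝ} (hε : 0 < ε)
    (x : EuclideanSpace ℝ (Fin N)) :
    bubble N ε x ^ ((2 * (N : ℝ)) / ((N : ℝ) - 4)) =
      ((N : ℝ) * ((N : ℝ) - 4) * ((N : ℝ) ^ 2 - 4)) ^ ((N : ℝ) / 4) * ε ^ ((N : ℝ) / 2) *
        (ε + ‖x‖ ^ 2) ^ (-(N : ℝ)) := by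
  have h5 : (5 : ℝ) ≤ N := by exact_mod_cast hN
  have h4 : (N : ℝ) - 4 ≠ 0 := by linarith
  have hK : 0 ≤ (N : ℝ) * ((N : ℝ) - 4) * ((N : ℝ) ^ 2 - 4) :=
    mul_nonneg (mul_nonneg (by linarith) (by linarith)) (by nlinarith)
  have hB : 0 ≤ ε + ‖x‖ ^ 2 := by positivity
  have hA : 0 ≤ (N : ℝ) * ((N : ℝ) - 4) * ((N : ℝ) ^ 2 - 4) * ε ^ 2 := by positivity
  have e₁ : ((N : ℝ) - 4) / 8 * (2 * N / (N - 4)) = N / 4 := by field_simp; norm_num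
  have e₂ : ((N : ℝ) - 4) / 2 * (2 * N / (N - 4)) = N := by field_simp
  have e₃ : ((2 : ℕ) : ℝ) * ((N : ℝ) / 4) = N / 2 := by push_cast; ring
  rw [bubble, div_rpow (rpow_nonneg hA _) (rpow_nonneg hB _), ← rpow_mul hA, ← rpow_mul hB,
    e₁, e₂, mul_rpow hK (by positivity), ← rpow_natCast ε 2, ← rpow_mul hε.le, e₃, rpow_neg hB,
    div_eq_mul_inv]

lemma bubble_nonneg (N : ℕ) (hN : 5 ≤ N) {ε : ℝ} (hε : 0 < ε)
    (x : EuclideanSpace ℝ (Fin N)) : 0 ≤ bubble N ε x := by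
  have h5 : (5 : ℝ) ≤ N := by exact_mod_cast hN
  have hK : 0 ≤ (N : ℝ) * ((N : ℝ) - 4) * ((N : ℝ) ^ 2 - 4) :=
    mul_nonneg (mul_nonneg (by linarith) (by linarith)) (by nlinarith)
  unfold bubble
  positivity

lemma continuous_bubble (N : ℕ) {ε : ℝ} (hε : 0 < ε) : Continuous (bubble N ε) := by
  have hB : ∀ x : EuclideanSpace ℝ (Fin N), 0 < ε + ‖x‖ ^ 2 := fun x => by positivity
  unfold bubble
  refine continuous_const.div (Continuous.rpow_const (by fun_prop) fun x => Or.inl (hB x).ne')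
    fun x => (rpow_pos_of_pos (hB x) _).ne'

lemma integrable_one_add_norm_sq_rpow_neg (N : ℕ) (hN : 0 < N) :
    Integrable fun x : EuclideanSpace ℝ (Fin N) => (1 + ‖x‖ ^ 2) ^ (-(N : ℝ)) := by
  have h : (Module.finrank ℝ (EuclideanSpace ℝ (Fin N)) : ℝ) < 2 * N := by
    have : (0 : ℝ) < N := by exact_mod_cast hN
    rw [finrank_euclideanSpace_fin]
    linarith
  have := integrable_rpow_neg_one_add_norm_sq (μ := (volume : Measure (EuclideanSpace ℝ (Fin N)))) h
  convert this using 3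
  ring

/-- If `c (1 + t) ≤ s` then `s⁻ⁿ ≤ c⁻ⁿ (1 + t)⁻ⁿ`. -/
lemma rpow_neg_le_mul_rpow_neg {c t s n : ℝ} (hc : 0 < c) (ht : 0 ≤ t) (hn : 0 ≤ n)
    (h : c * (1 + t) ≤ s) : s ^ (-n) ≤ c ^ (-n) * (1 + t) ^ (-n) := by
  rw [← mul_rpow hc.le (by positivity)]
  exact rpow_le_rpow_of_nonpos (by positivity) h (by linarith)

lemma integrable_bubble_rpow_critical (N : ℕ) (hN : 5 ≤ N) {ε : ℝ} (hε : 0 < ε) (hε1 : ε ≤ 1) :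
    Integrable fun x : EuclideanSpace ℝ (Fin N) =>
      bubble N ε x ^ ((2 * (N : ℝ)) / ((N : ℝ) - 4)) := by
  simp_rw [bubble_rpow_critical N hN hε]
  refine Integrable.const_mul ?_ _
  refine ((integrable_one_add_norm_sq_rpow_neg N (by omega)).const_mul (ε ^ (-(N : ℝ)))).mono' ?_ ?_
  · refine (Continuous.rpow_const (by fun_prop) fun x => Or.inl ?_).aestronglyMeasurable
    positivity
  · refine ae_of_all _ fun x => ?_
    rw [Real.norm_of_nonneg (by positivity)]
    exact rpow_neg_le_mul_rpow_neg hε (sq_nonneg _) (Nat.cast_nonneg _)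
      (by nlinarith [sq_nonneg ‖x‖])

/-- For `5 ≤ N ≤ 7`: there is `δ ∈ (0,1)` with
`∫ V_ε^{2N/(N−4)} = ∫ u_ε^{2N/(N−4)} + O(ε^{(N−4+δ)/2})` as `ε → 0⁺`. -/
theorem cutBubble_critical_norm_estimate_low_dim (N : ℕ) (hN : 5 ≤ N) (hN' : N ≤ 7)
    (ρ : ℝ) (hρ : 0 < ρ)
    (g : ℝ → ℝ) (hg : ContDiff ℝ (⊤ : ℕ∞) g)
    (hg01 : ∀ r : ℝ, 0 ≤ r → g r ∈ Set.Icc (0 : ℝ) 1)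
    (hg1 : ∀ r : ℝ, 0 ≤ r → r ≤ ρ → g r = 1)
    (hg0 : ∀ r : ℝ, 2 * ρ ≤ r → g r = 0) :
    ∃ δ : ℝ, δ ∈ Set.Ioo (0 : ℝ) 1 ∧
      (fun ε : ℝ =>
          (∫ x : EuclideanSpace ℝ (Fin N),
              (cutBubble N g ε x) ^ ((2 * (N : ℝ)) / ((N : ℝ) - 4)))
            - ∫ x : EuclideanSpace ℝ (Fin N),
                (bubble N ε x) ^ ((2 * (N : ℝ)) / ((N : ℝ) - 4)))
        =O[𝓝[>] (0 : ℝ)] (fun ε : ℝ => ε ^ (((N : ℝ) - 4 + δ) / 2)) := by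
  have h5 : (5 : ℝ) ≤ N := by exact_mod_cast hN
  set p : ℝ := (2 * (N : ℝ)) / ((N : ℝ) - 4)
  have hp : 0 ≤ p := div_nonneg (by linarith) (by linarith)
  have hK : 0 ≤ (N : ℝ) * ((N : ℝ) - 4) * ((N : ℝ) ^ 2 - 4) :=
    mul_nonneg (mul_nonneg (by linarith) (by linarith)) (by nlinarith)
  set K : ℝ := ((N : ℝ) * ((N : ℝ) - 4) * ((N : ℝ) ^ 2 - 4)) ^ ((N : ℝ) / 4)
  have hK0 : 0 ≤ K := rpow_nonneg hK _
  set c : ℝ := ρ ^ 2 / (1 + ρ ^ 2) with hc_def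
  have hc : 0 < c := by positivity
  set J : EuclideanSpace ℝ (Fin N) → ℝ := fun x => (1 + ‖x‖ ^ 2) ^ (-(N : ℝ))
  have hJ : Integrable J := integrable_one_add_norm_sq_rpow_neg N (by omega)
  have hJ0 : ∀ x, 0 ≤ J x := fun x => by positivity
  refine ⟨1 / 2, by norm_num, ?_⟩
  refine IsBigO.of_bound (K * c ^ (-(N : ℝ)) * ∫ x, J x) ?_
  filter_upwards [Ioc_mem_nhdsGT (zero_lt_one' ℝ)] with ε hε
  obtain ⟨hε, hε1⟩ := hε
  have hu0 := bubble_nonneg N hN hε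
  have hU := integrable_bubble_rpow_critical N hN hε hε1
  have hVle : ∀ x, 0 ≤ cutBubble N g ε x ^ p ∧ cutBubble N g ε x ^ p ≤ bubble N ε x ^ p := by
    intro x
    obtain ⟨h0, h1⟩ := hg01 ‖x‖ (norm_nonneg x)
    have hV0 : 0 ≤ cutBubble N g ε x := mul_nonneg h0 (hu0 x)
    exact ⟨rpow_nonneg hV0 _, rpow_le_rpow hV0 (mul_le_of_le_one_left (hu0 x) h1) hp⟩
  have hV : Integrable fun x => cutBubble N g ε x ^ p := by
    refine hU.mono' ?_ (ae_of_all _ fun x => ?_)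
    · refine (Continuous.rpow_const ?_ fun x => Or.inr hp).aestronglyMeasurable
      exact (hg.continuous.comp continuous_norm).mul (continuous_bubble N hε)
    · rw [Real.norm_of_nonneg (hVle x).1]
      exact (hVle x).2
  have hbound : ∀ x, ‖cutBubble N g ε x ^ p - bubble N ε x ^ p‖ ≤
      K * c ^ (-(N : ℝ)) * ε ^ ((N : ℝ) / 2) * J x := by
    intro x
    rcases le_total ‖x‖ ρ with hx | hx
    · have h0 := hJ0 x
      simp only [cutBubble, hg1 _ (norm_nonneg x) hx, one_mul, sub_self, norm_zero]
      positivity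
    · have hle : c * (1 + ‖x‖ ^ 2) ≤ ε + ‖x‖ ^ 2 := by
        have : c * (1 + ‖x‖ ^ 2) ≤ ‖x‖ ^ 2 := by
          rw [hc_def, div_mul_eq_mul_div, div_le_iff₀ (by positivity)]
          nlinarith [pow_le_pow_left₀ hρ.le hx 2]
        linarith
      have hdecay := rpow_neg_le_mul_rpow_neg hc (sq_nonneg ‖x‖) (Nat.cast_nonneg N) hle
      rw [norm_sub_rev, Real.norm_of_nonneg (sub_nonneg.2 (hVle x).2)]
      calc bubble N ε x ^ p - cutBubble N g ε x ^ p ≤ bubble N ε x ^ p := by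
            linarith [(hVle x).1]
        _ = K * ε ^ ((N : ℝ) / 2) * (ε + ‖x‖ ^ 2) ^ (-(N : ℝ)) := bubble_rpow_critical N hN hε x
        _ ≤ K * ε ^ ((N : ℝ) / 2) * (c ^ (-(N : ℝ)) * J x) := by gcongr
        _ = _ := by ring
  rw [← integral_sub hV hU, Real.norm_of_nonneg (rpow_nonneg hε.le _)]
  calc ‖∫ x, (cutBubble N g ε x ^ p - bubble N ε x ^ p)‖
      ≤ ∫ x, K * c ^ (-(N : ℝ)) * ε ^ ((N : ℝ) / 2) * J x :=
        norm_integral_le_of_norm_le (hJ.const_mul _) (ae_of_all _ hbound)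
    _ = (K * c ^ (-(N : ℝ)) * ∫ x, J x) * ε ^ ((N : ℝ) / 2) := by
        rw [integral_const_mul]; ring
    _ ≤ (K * c ^ (-(N : ℝ)) * ∫ x, J x) * ε ^ (((N : ℝ) - 4 + 1 / 2) / 2) := by
        have : 0 ≤ ∫ x, J x := integral_nonneg hJ0
        exact mul_le_mul_of_nonneg_left
          (rpow_le_rpow_of_exponent_ge hε hε1 (by linarith)) (by positivity)
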